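/- Let H be a complex Hilbert space, n ≥ 1, let Z₁,…,Zₙ be pairwise distinct operators on H with ‖Zᵢ‖ < 1, and let W₁,…,Wₙ be operators on H with ‖Wᵢ‖ ≤ 1. Then there exists a sequence a : ℕ → ℂ such that for every z ∈ ℂ with |z| < 1 the series ∑ₖ aₖ zᵏ is summable with |∑'ₖ aₖ zᵏ| ≤ 1 and for each i the series ∑ₖ aₖ • Zᵢᵏ is summable in B(H) with sum Wᵢ, if and only if Φ_W completely dominates Φ_Z in the sense of Lyapunov. -/

import Mathlib

/-!
STATEMENT 7: Let H be a complex Hilbert space, n ≥ 1, let Z₁,…,Zₙ be pairwise distinct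
operators on H with ‖Zᵢ‖ < 1, and let W₁,…,Wₙ be operators on H with ‖Wᵢ‖ ≤ 1.  Then there
exists a sequence a : ℕ → ℂ such that for every z ∈ ℂ with |z| < 1 the series ∑ₖ aₖ zᵏ is
summable with |∑'ₖ aₖ zᵏ| ≤ 1 and for each i the series ∑ₖ aₖ • Zᵢᵏ is summable in B(H) with
sum Wᵢ, if and only if Φ_W completely dominates Φ_Z in the sense of Lyapunov.

Matrix algebras are realized with `Matrix (Fin k) (Fin k) _`; the C*-order is expressed by
the characterization `0 ≤ a ↔ ∃ b, a = star b * b`.  Norm convergence `Φⁿ(a) → 0` in the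
matrix C*-algebra `Mₖ(Mₙ(B(H)))` is expressed through the canonical isometric identification
of this algebra with operators on `(H^n)^k` (iterated `toOp`).
-/

set_option synthInstance.maxHeartbeats 1000000
set_option maxHeartbeats 1000000

open Filter ContinuousLinearMap

/-- The entrywise amplification of a map to `k × k` matrices. -/
def ampl {A B : Type*} (k : ℕ) (f : A → B) (a : Matrix (Fin k) (Fin k) A) :
    Matrix (Fin k) (Fin k) B :=
  Matrix.of fun i j => f (a i j)

/-- Nonnegativity in a matrix algebra over a C*-algebra, via the characterization of the
positive cone as `{star b * b}`. -/
def StarNonneg {A : Type*} [Mul A] [Star A] (a : A) : Prop :=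
  ∃ b, a = star b * b

/-- The C*-order: `a ≤ b` iff `b - a` is nonnegative. -/
def StarLE {A : Type*} [Mul A] [Star A] [Sub A] (a b : A) : Prop :=
  StarNonneg (b - a)

variable {H : Type*} [NormedAddCommGroup H] [InnerProductSpace ℂ H] [CompleteSpace H]

/-- The map `Φ_Z : a ↦ (Zᵢ ∘ aᵢⱼ ∘ Zⱼ*)` on `Mₙ(B(H))` determined by an `n`-tuple `Z` of
operators on `H`. -/
noncomputable def PhiMap {n : ℕ} (Z : Fin n → H →L[ℂ] H)
    (a : Matrix (Fin n) (Fin n) (H →L[ℂ] H)) : Matrix (Fin n) (Fin n) (H →L[ℂ] H) :=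
  Matrix.of fun i j => Z i ∘L a i j ∘L ContinuousLinearMap.adjoint (Z j)

/-- The canonical action of a matrix of operators on the Hilbert space direct sum
`K^m = PiLp 2 (fun _ : Fin m => K)`: `(toOp q) h i = ∑ j, q i j (h j)`.  This realizes the
isometric *-isomorphism `Mₘ(B(K)) ≃ B(K^m)` giving `Mₘ(B(K))` its C*-norm. -/
noncomputable def toOp {K : Type*} [NormedAddCommGroup K] [InnerProductSpace ℂ K] {m : ℕ}
    (q : Matrix (Fin m) (Fin m) (K →L[ℂ] K)) :
    PiLp 2 (fun _ : Fin m => K) →L[ℂ] PiLp 2 (fun _ : Fin m => K) :=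
  (PiLp.continuousLinearEquiv 2 ℂ (fun _ : Fin m => K)).symm.toContinuousLinearMap ∘L
    (ContinuousLinearMap.pi fun i => ∑ j, (q i j) ∘L (ContinuousLinearMap.proj j) ∘L
      (PiLp.continuousLinearEquiv 2 ℂ (fun _ : Fin m => K)).toContinuousLinearMap)

/-- `Φ_W` completely dominates `Φ_Z` in the sense of Lyapunov: for every `k ≥ 1`, every pure
superharmonic element of `Mₖ(Mₙ(B(H)))` for `Φ_Z⁽ᵏ⁾` (superharmonic, with iterates tending
to `0` in the C*-norm of `Mₖ(Mₙ(B(H))) ≅ B((H^n)^k)`) is superharmonic for `Φ_W⁽ᵏ⁾`. -/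
noncomputable def CompletelyLyapunovDominates {n : ℕ} (Z W : Fin n → H →L[ℂ] H) : Prop :=
  ∀ k : ℕ, 1 ≤ k →
    ∀ q : Matrix (Fin k) (Fin k) (Matrix (Fin n) (Fin n) (H →L[ℂ] H)),
      (StarNonneg q ∧ StarLE (ampl k (PhiMap Z) q) q ∧
        Tendsto (fun N : ℕ => ‖toOp (ampl k (toOp (K := H) (m := n)) ((ampl k (PhiMap Z))^[N] q))‖)
          atTop (nhds 0)) →
      (StarNonneg q ∧ StarLE (ampl k (PhiMap W) q) q)

/-- Interpolation by a function in the closed unit ball of `H^∞(𝔻)`, expressed through its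
power series coefficients: `f(z) = ∑ aₖ zᵏ` has modulus at most `1` on the disc and
`f(Zᵢ) = ∑ aₖ Zᵢᵏ = Wᵢ` via the absolutely convergent power-series functional calculus. -/
def InterpolatesHInfty {n : ℕ} (Z W : Fin n → H →L[ℂ] H) : Prop :=
  ∃ a : ℕ → ℂ,
    (∀ z : ℂ, ‖z‖ < 1 →
      Summable (fun k : ℕ => a k * z ^ k) ∧ ‖∑' k : ℕ, a k * z ^ k‖ ≤ 1) ∧
    ∀ i, HasSum (fun k : ℕ => a k • (Z i) ^ k) (W i)

section VonNeumann

variable {E : Type*} [NormedAddCommGroup E] [InnerProductSpace ℂ E] [CompleteSpace E]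

theorem norm_aeval_le_of_mem_unitary {u : E →L[ℂ] E} (hu : u ∈ unitary (E →L[ℂ] E))
    (p : Polynomial ℂ) {c : ℝ} (hc : 0 ≤ c) (hp : ∀ z : ℂ, ‖z‖ = 1 → ‖p.eval z‖ ≤ c) :
    ‖Polynomial.aeval u p‖ ≤ c := by
  have hn : IsStarNormal u := isStarNormal_of_mem_unitary hu
  rw [← cfc_polynomial p u]
  exact norm_cfc_le hc fun z hz =>
    hp z (by simpa using spectrum.subset_circle_of_unitary hu hz)

/-- The shift `h ↦ h (· + 1)` on `E`-valued functions on `ZMod N`. -/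
noncomputable def cyclicShift (E : Type*) [NormedAddCommGroup E] [InnerProductSpace ℂ E]
    [CompleteSpace E] (N : ℕ) [NeZero N] :
    unitary (PiLp 2 (fun _ : ZMod N => E) →L[ℂ] PiLp 2 (fun _ : ZMod N => E)) :=
  Unitary.linearIsometryEquiv.symm
    (LinearIsometryEquiv.piLpCongrLeft 2 ℂ E (Equiv.addRight (1 : ZMod N)).symm)

theorem cyclicShift_apply (N : ℕ) [NeZero N] (h : PiLp 2 (fun _ : ZMod N => E)) (j : ZMod N) :
    (cyclicShift E N).1 h j = h (j + 1) := by
  simp [cyclicShift, LinearIsometryEquiv.piLpCongrLeft_apply, Equiv.piCongrLeft'_apply]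

theorem cyclicShift_pow_apply (N : ℕ) [NeZero N] (k : ℕ) (h : PiLp 2 (fun _ : ZMod N => E))
    (j : ZMod N) :
    ((cyclicShift E N).1 ^ k) h j = h (j + k) := by
  induction k generalizing j with
  | zero => simp
  | succ k ih =>
    rw [pow_succ', mul_apply_eq_comp, cyclicShift_apply, ih, Nat.cast_succ, add_assoc,
      add_comm (1 : ZMod N)]

/-- Discrete form of the boundedness of Toeplitz operators with polynomial symbol. -/
theorem sum_norm_sq_sum_smul_le (h : ℕ → E) (b : ℕ → ℂ) {M : ℕ} {c : ℝ} (hc : 0 ≤ c)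
    (hb : ∀ z : ℂ, ‖z‖ = 1 → ‖∑ k ∈ Finset.range M, b k * z ^ k‖ ≤ c) (L : ℕ) :
    ∑ j ∈ Finset.range L, ‖∑ k ∈ Finset.range M, b k • h (j + k)‖ ^ 2 ≤
      c ^ 2 * ∑ j ∈ Finset.range (L + M + 1), ‖h j‖ ^ 2 := by
  set N := L + M + 1 with hN
  have : NeZero N := ⟨by omega⟩
  let p : Polynomial ℂ := ∑ k ∈ Finset.range M, b k • (Polynomial.X : Polynomial ℂ) ^ k
  let g : PiLp 2 (fun _ : ZMod N => E) := WithLp.toLp 2 fun j => h j.val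
  have hval : ∀ j < N, ((j : ZMod N)).val = j := fun j hj => ZMod.val_natCast_of_lt hj
  have hsum : ∀ f : ℕ → ℝ, ∑ j : ZMod N, f j.val = ∑ j ∈ Finset.range N, f j := by
    intro f
    refine Finset.sum_bij (fun j _ => j.val) (fun j _ => by simpa using ZMod.val_lt j)
      (fun _ _ _ _ h => ZMod.val_injective N h) (fun j hj => ⟨j, by simp, ?_⟩) (fun _ _ => rfl)
    exact hval j (by simpa using hj)
  have hg : ‖g‖ ^ 2 = ∑ j ∈ Finset.range N, ‖h j‖ ^ 2 := by
    rw [PiLp.norm_sq_eq_of_L2, ← hsum fun j => ‖h j‖ ^ 2]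
  set U : PiLp 2 (fun _ : ZMod N => E) →L[ℂ] _ := (cyclicShift E N).1 with hU
  have hUp : ‖Polynomial.aeval U p‖ ≤ c :=
    norm_aeval_le_of_mem_unitary (cyclicShift E N).2 p hc fun z hz => by
      simpa [p, Polynomial.eval_finsetSum] using hb z hz
  have hpg : ∀ j < L, Polynomial.aeval U p g ((j : ℕ) : ZMod N) =
      ∑ k ∈ Finset.range M, b k • h (j + k) := by
    intro j hj
    simp only [p, map_sum, map_smul, map_pow, Polynomial.aeval_X, _root_.sum_apply,
      _root_.smul_apply, WithLp.ofLp_sum, Finset.sum_apply, PiLp.smul_apply]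
    refine Finset.sum_congr rfl fun k hk => ?_
    rw [cyclicShift_pow_apply]
    have := Finset.mem_range.1 hk
    simp only [g]
    rw [← Nat.cast_add, hval _ (by omega)]
  calc ∑ j ∈ Finset.range L, ‖∑ k ∈ Finset.range M, b k • h (j + k)‖ ^ 2
      = ∑ j ∈ Finset.range L, ‖Polynomial.aeval U p g ((j : ℕ) : ZMod N)‖ ^ 2 :=
        Finset.sum_congr rfl fun j hj => by rw [hpg j (Finset.mem_range.1 hj)]
    _ ≤ ∑ j ∈ Finset.range N, ‖Polynomial.aeval U p g ((j : ℕ) : ZMod N)‖ ^ 2 :=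
        Finset.sum_le_sum_of_subset_of_nonneg (Finset.range_mono (by omega))
          fun _ _ _ => by positivity
    _ = ‖Polynomial.aeval U p g‖ ^ 2 := by
        rw [PiLp.norm_sq_eq_of_L2, ← hsum]
        exact Finset.sum_congr rfl fun j _ => by rw [ZMod.natCast_zmod_val]
    _ ≤ (c * ‖g‖) ^ 2 := by
        gcongr
        exact (le_opNorm _ _).trans (by gcongr)
    _ = _ := by rw [mul_pow, hg]

end VonNeumann

section SeminormContraction

variable {E : Type*} [NormedAddCommGroup E] [InnerProductSpace ℂ E]

theorem tendsto_pow_apply_of_norm_lt_one {T : E →L[ℂ] E} (hT : ‖T‖ < 1) (x : E) :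
    Tendsto (fun N : ℕ => (T ^ N) x) atTop (nhds 0) := by
  have := ((ContinuousLinearMap.apply ℂ E x).continuous.tendsto 0).comp
    (tendsto_pow_atTop_nhds_zero_of_norm_lt_one hT)
  rw [map_zero] at this
  exact this

variable [CompleteSpace E]

/-- Von Neumann's inequality for polynomials in an operator that is contractive for the
seminorm `‖R ·‖`. -/
theorem norm_apply_sum_pow_le {T R S : E →L[ℂ] E} (hT : ‖T‖ < 1)
    (hS : ∀ x, ‖S x‖ ^ 2 = ‖R x‖ ^ 2 - ‖R (T x)‖ ^ 2) (b : ℕ → ℂ) {M : ℕ} {c : ℝ} (hc : 0 ≤ c)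
    (hb : ∀ z : ℂ, ‖z‖ = 1 → ‖∑ k ∈ Finset.range M, b k * z ^ k‖ ≤ c) (x : E) :
    ‖R ((∑ k ∈ Finset.range M, b k • T ^ k) x)‖ ≤ c * ‖R x‖ := by
  have hsum : ∀ (x : E) (L : ℕ),
      ∑ j ∈ Finset.range L, ‖S ((T ^ j) x)‖ ^ 2 = ‖R x‖ ^ 2 - ‖R ((T ^ L) x)‖ ^ 2 := by
    intro x L
    have := Finset.sum_range_sub' (fun j => ‖R ((T ^ j) x)‖ ^ 2) L
    simpa [hS, pow_succ'] using this
  set y := (∑ k ∈ Finset.range M, b k • T ^ k) x with hy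
  have hle : ∀ L : ℕ, ‖R y‖ ^ 2 - ‖R ((T ^ L) y)‖ ^ 2 ≤ c ^ 2 * ‖R x‖ ^ 2 := by
    intro L
    have := sum_norm_sq_sum_smul_le (fun j => S ((T ^ j) x)) b hc hb L
    rw [hsum] at this
    rw [← hsum]
    have h2 : ∀ j, S ((T ^ j) y) = ∑ k ∈ Finset.range M, b k • S ((T ^ (j + k)) x) := by
      intro j
      simp [hy, _root_.sum_apply, map_sum, map_smul, pow_add]
    simp only [h2]
    refine this.trans ?_
    gcongr
    exact sub_le_self _ (by positivity)
  have hlim : Tendsto (fun L : ℕ => ‖R y‖ ^ 2 - ‖R ((T ^ L) y)‖ ^ 2) atTop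
      (nhds (‖R y‖ ^ 2 - ‖R 0‖ ^ 2)) :=
    tendsto_const_nhds.sub
      ((((R.continuous.tendsto 0).comp (tendsto_pow_apply_of_norm_lt_one hT y)).norm).pow 2)
  have := le_of_tendsto' hlim hle
  rw [map_zero, norm_zero, ← mul_pow] at this
  exact le_of_sq_le_sq (by simpa using this) (by positivity)

theorem norm_apply_hasSum_le {T R S F : E →L[ℂ] E} (hT : ‖T‖ < 1)
    (hS : ∀ x, ‖S x‖ ^ 2 = ‖R x‖ ^ 2 - ‖R (T x)‖ ^ 2) {b : ℕ → ℂ}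
    (hb : ∀ z : ℂ, ‖z‖ < 1 → Summable (fun k => b k * z ^ k) ∧ ‖∑' k, b k * z ^ k‖ ≤ 1)
    (hF : HasSum (fun k => b k • T ^ k) F) (x : E) : ‖R (F x)‖ ≤ ‖R x‖ := by
  have habs : ∀ r : ℝ, 0 ≤ r → r < 1 → Summable fun k => ‖b k‖ * r ^ k := by
    intro r h0 h1
    have := (hb (r : ℂ) (by simpa [abs_of_nonneg h0] using h1)).1.norm
    simpa [abs_of_nonneg h0] using this
  have hTb : ∀ (r : ℝ) (k : ℕ), 0 ≤ r → r ≤ 1 →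
      ‖(b k * (r : ℂ) ^ k) • T ^ k‖ ≤ ‖b k‖ * ‖T‖ ^ k := by
    intro r k h0 h1
    rw [norm_smul, norm_mul, norm_pow, Complex.norm_real, Real.norm_of_nonneg h0, mul_assoc]
    gcongr
    calc r ^ k * ‖T ^ k‖ ≤ 1 * ‖T‖ ^ k := by
          rcases k with _ | k
          · simpa [one_def] using norm_id_le (𝕜 := ℂ) (E := E)
          · gcongr
            · exact pow_le_one₀ h0 h1
            · exact norm_pow_le' T (Nat.succ_pos k)
      _ = _ := one_mul _
  have hr : ∀ r : ℝ, 0 ≤ r → r < 1 →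
      ‖R ((∑' k, (b k * (r : ℂ) ^ k) • T ^ k) x)‖ ≤ ‖R x‖ := by
    intro r h0 h1
    have hsT : Summable fun k => (b k * (r : ℂ) ^ k) • T ^ k :=
      Summable.of_norm_bounded (habs _ (norm_nonneg T) hT) fun k => hTb r k h0 h1.le
    have htail := tendsto_sum_nat_add fun k => ‖b k‖ * r ^ k
    have hM : ∀ M : ℕ, ‖R ((∑ k ∈ Finset.range M, (b k * (r : ℂ) ^ k) • T ^ k) x)‖ ≤
        (1 + ∑' k, ‖b (k + M)‖ * r ^ (k + M)) * ‖R x‖ := by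
      intro M
      refine norm_apply_sum_pow_le hT hS _ (add_nonneg zero_le_one
        (tsum_nonneg fun k => by positivity)) (fun z hz => ?_) x
      have hzr : ‖(r : ℂ) * z‖ = r := by simp [hz, abs_of_nonneg h0]
      obtain ⟨hs, hle⟩ := hb (r * z) (by rwa [hzr])
      have heq : ∑ k ∈ Finset.range M, b k * (r : ℂ) ^ k * z ^ k =
          (∑' k, b k * (r * z) ^ k) - ∑' k, b (k + M) * (r * z) ^ (k + M) := by
        rw [← hs.sum_add_tsum_nat_add M, add_sub_cancel_right]
        simp [mul_pow, mul_assoc]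
      rw [heq]
      refine (norm_sub_le _ _).trans (add_le_add hle ?_)
      refine tsum_of_norm_bounded (((summable_nat_add_iff M).2 (habs r h0 h1)).hasSum)
        fun k => ?_
      rw [norm_mul, norm_pow, hzr]
    have hl : Tendsto (fun M : ℕ => ‖R ((∑ k ∈ Finset.range M, (b k * (r : ℂ) ^ k) • T ^ k) x)‖)
        atTop (nhds ‖R ((∑' k, (b k * (r : ℂ) ^ k) • T ^ k) x)‖) :=
      ((R.continuous.tendsto _).comp
        (((ContinuousLinearMap.apply ℂ E x).continuous.tendsto _).comp
          hsT.hasSum.tendsto_sum_nat)).norm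
    refine le_of_tendsto_of_tendsto' hl ?_ hM
    simpa using (htail.const_add 1).mul_const ‖R x‖
  have hlim : Tendsto (fun r : ℝ => ∑' k, (b k * (r : ℂ) ^ k) • T ^ k) (nhdsWithin 1 (Set.Iio 1))
      (nhds (∑' k, b k • T ^ k)) := by
    refine tendsto_tsum_of_dominated_convergence (habs _ (norm_nonneg T) hT) (fun k => ?_) ?_
    · have : Continuous fun r : ℝ => (b k * (r : ℂ) ^ k) • T ^ k := by fun_prop
      simpa using (this.tendsto 1).mono_left nhdsWithin_le_nhds
    · filter_upwards [self_mem_nhdsWithin, nhdsWithin_le_nhds (Ioi_mem_nhds zero_lt_one)]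
        with r h1 h0 k using hTb r k (le_of_lt h0) (le_of_lt h1)
  rw [hF.tsum_eq] at hlim
  refine le_of_tendsto ((R.continuous.tendsto _).comp
    (((ContinuousLinearMap.apply ℂ E x).continuous.tendsto _).comp hlim)).norm ?_
  filter_upwards [self_mem_nhdsWithin, nhdsWithin_le_nhds (Ioi_mem_nhds zero_lt_one)]
    with r h1 h0 using hr r (le_of_lt h0) h1

theorem ofReal_norm_sq_eq_inner_star_mul (R : E →L[ℂ] E) (x : E) :
    ((‖R x‖ ^ 2 : ℝ) : ℂ) = inner ℂ ((star R * R) x) x := by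
  rw [mul_apply_eq_comp, star_eq_adjoint, adjoint_inner_left, inner_self_eq_norm_sq_to_K]
  norm_cast

theorem exists_defect_operator (L : E →L[ℂ] E) (hL : ∀ x, ‖L x‖ ≤ ‖x‖) :
    ∃ R : E →L[ℂ] E, ∀ x, ‖R x‖ ^ 2 = ‖x‖ ^ 2 - ‖L x‖ ^ 2 := by
  have hform : ∀ x, inner ℂ ((1 - star L * L) x) x = ((‖x‖ ^ 2 - ‖L x‖ ^ 2 : ℝ) : ℂ) := by
    intro x
    rw [_root_.sub_apply, inner_sub_left, ← ofReal_norm_sq_eq_inner_star_mul, one_apply_eq_self,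
      inner_self_eq_norm_sq_to_K]
    push_cast
    rfl
  have hpos : 0 ≤ 1 - star L * L := by
    rw [nonneg_iff_isPositive, isPositive_iff_complex]
    intro x
    rw [hform]
    refine ⟨by rw [RCLike.re_to_complex, Complex.ofReal_re], ?_⟩
    rw [RCLike.re_to_complex, Complex.ofReal_re, sub_nonneg]
    gcongr
    exact hL x
  obtain ⟨R, hR⟩ := CStarAlgebra.nonneg_iff_eq_star_mul_self.1 hpos
  refine ⟨R, fun x => Complex.ofReal_injective ?_⟩
  rw [ofReal_norm_sq_eq_inner_star_mul, ← hR, hform]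

/-- If `F = f(D)` with `f` in the unit ball of `H^∞`, every positive solution of
`D Q D* ≤ Q` satisfies `F Q F* ≤ Q`. -/
theorem conj_le_of_hasSum {D F Q : E →L[ℂ] E} (hD : ‖D‖ < 1) {a : ℕ → ℂ}
    (ha : ∀ z : ℂ, ‖z‖ < 1 → Summable (fun k => a k * z ^ k) ∧ ‖∑' k, a k * z ^ k‖ ≤ 1)
    (hF : HasSum (fun k => a k • D ^ k) F) (hQ : 0 ≤ Q) (hDQ : D * Q * star D ≤ Q) :
    F * Q * star F ≤ Q := by
  obtain ⟨R, rfl⟩ := CStarAlgebra.nonneg_iff_eq_star_mul_self.1 hQ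
  obtain ⟨S, hS⟩ := CStarAlgebra.nonneg_iff_eq_star_mul_self.1 (sub_nonneg.2 hDQ)
  have hconj : ∀ (G : E →L[ℂ] E) (x : E),
      inner ℂ ((star R * R - G * (star R * R) * star G) x) x =
        ((‖R x‖ ^ 2 - ‖R (star G x)‖ ^ 2 : ℝ) : ℂ) := by
    intro G x
    have h := ofReal_norm_sq_eq_inner_star_mul (R * star G) x
    rw [star_mul, star_star, mul_apply_eq_comp] at h
    rw [Complex.ofReal_sub, ofReal_norm_sq_eq_inner_star_mul R x, h, _root_.sub_apply,
      inner_sub_left]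
    simp only [mul_assoc]
  have hb : ∀ z : ℂ, ‖z‖ < 1 → Summable (fun k => star (a k) * z ^ k) ∧
      ‖∑' k, star (a k) * z ^ k‖ ≤ 1 := by
    intro z hz
    obtain ⟨h1, h2⟩ := ha (star z) (by simpa using hz)
    have h3 : (fun k => star (a k) * z ^ k) = fun k => star (a k * star z ^ k) := by
      ext k; simp
    rw [h3]
    exact ⟨h1.star, by rw [← tsum_star, norm_star]; exact h2⟩
  have hF' : HasSum (fun k => star (a k) • star D ^ k) (star F) := by
    simpa using hF.star
  have key := norm_apply_hasSum_le (T := star D) (R := R) (S := S) (by rwa [norm_star])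
    (fun x => by
      have := hconj D x
      rw [hS, ← ofReal_norm_sq_eq_inner_star_mul] at this
      exact_mod_cast this) hb hF'
  rw [← sub_nonneg, nonneg_iff_isPositive, isPositive_iff_complex]
  intro x
  rw [hconj]
  refine ⟨by rw [RCLike.re_to_complex, Complex.ofReal_re], ?_⟩
  simp only [RCLike.re_to_complex, Complex.ofReal_re, sub_nonneg]
  gcongr
  exact key x

end SeminormContraction

section Realization

theorem exists_contraction_extension {X G G' : Type*} [AddCommGroup X] [Module ℂ X]
    [NormedAddCommGroup G] [InnerProductSpace ℂ G] [CompleteSpace G]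
    [NormedAddCommGroup G'] [NormedSpace ℂ G'] [CompleteSpace G']
    (α : X →ₗ[ℂ] G) (β : X →ₗ[ℂ] G') (h : ∀ x, ‖β x‖ ≤ ‖α x‖) :
    ∃ U : G →L[ℂ] G', (∀ g, ‖U g‖ ≤ ‖g‖) ∧ ∀ x, U (α x) = β x := by
  set S := (LinearMap.range α).topologicalClosure with hS
  have hmem : ∀ x, α x ∈ S := fun x =>
    Submodule.le_topologicalClosure _ (LinearMap.mem_range_self α x)
  let e : X →ₗ[ℂ] S := α.codRestrict S hmem
  have hd : DenseRange e := by
    intro y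
    rw [closure_subtype]
    have hy : (y : G) ∈ closure (LinearMap.range α : Set G) := y.2
    refine closure_mono ?_ hy
    rintro _ ⟨x, rfl⟩
    exact ⟨e x, ⟨x, rfl⟩, rfl⟩
  have hb : ∀ x, ‖β x‖ ≤ 1 * ‖e x‖ := fun x => by simpa [e] using h x
  have : CompleteSpace S := (Submodule.isClosed_topologicalClosure _).completeSpace_coe
  refine ⟨(β.extendOfNorm e) ∘L S.orthogonalProjectionOnto, fun g => ?_, fun x => ?_⟩
  · refine (LinearMap.norm_extendOfNorm_apply_le hd 1 hb _).trans ?_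
    rw [one_mul]
    exact S.norm_orthogonalProjectionOnto_apply_le g
  · rw [comp_apply]
    have : S.orthogonalProjectionOnto (α x) = e x :=
      S.orthogonalProjectionOnto_mem_subspace_eq_self (e x)
    rw [this, LinearMap.extendOfNorm_eq hd ⟨1, hb⟩]

theorem norm_pow_apply_le {G : Type*} [SeminormedAddCommGroup G] [NormedSpace ℂ G]
    (A : G →L[ℂ] G) (k : ℕ) (x : G) : ‖(A ^ k) x‖ ≤ ‖A‖ ^ k * ‖x‖ := by
  induction k with
  | zero => simp
  | succ k ih =>
    rw [pow_succ', mul_apply_eq_comp, pow_succ', mul_assoc]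
    exact (le_opNorm _ _).trans (by gcongr)

/-- The transfer function of a contraction on `G ⊕ ℂ` lies in the unit ball of `H^∞`. -/
theorem exists_transfer_function {G : Type*} [NormedAddCommGroup G] [InnerProductSpace ℂ G]
    [CompleteSpace G] (U : WithLp 2 (G × ℂ) →L[ℂ] WithLp 2 (G × ℂ)) (hU : ∀ g, ‖U g‖ ≤ ‖g‖) :
    ∃ a : ℕ → ℂ, (∀ k, ‖a k‖ ≤ 1) ∧
      (∀ z : ℂ, ‖z‖ < 1 → Summable (fun k => a k * z ^ k) ∧ ‖∑' k, a k * z ^ k‖ ≤ 1) ∧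
      ∀ (u : ℕ → G) (m ν : ℕ → ℂ),
        (∀ N, U (WithLp.toLp 2 (u (N + 1), m N)) = WithLp.toLp 2 (u N, ν N)) →
        Tendsto u atTop (nhds 0) →
        Tendsto (fun N => ∑ k ∈ Finset.range N, a k * m k) atTop (nhds (ν 0)) := by
  let P := WithLp.prodContinuousLinearEquiv 2 ℂ G ℂ
  let A : G →L[ℂ] G := fst ℂ G ℂ ∘L P.toContinuousLinearMap ∘L U ∘L
    P.symm.toContinuousLinearMap ∘L inl ℂ G ℂ
  let C : G →L[ℂ] ℂ := snd ℂ G ℂ ∘L P.toContinuousLinearMap ∘L U ∘L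
    P.symm.toContinuousLinearMap ∘L inl ℂ G ℂ
  let β : G := (U (WithLp.toLp 2 (0, 1))).fst
  let d : ℂ := (U (WithLp.toLp 2 (0, 1))).snd
  have hUeq : ∀ (g : G) (t : ℂ),
      U (WithLp.toLp 2 (g, t)) = WithLp.toLp 2 (A g + t • β, C g + t * d) := by
    intro g t
    have h1 : (WithLp.toLp 2 (g, t) : WithLp 2 (G × ℂ)) =
        WithLp.toLp 2 (g, 0) + t • WithLp.toLp 2 (0, 1) := by
      rw [← WithLp.toLp_smul, ← WithLp.toLp_add]; simp
    rw [h1, map_add, map_smul]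
    rfl
  have hsq : ∀ (g : G) (t : ℂ),
      ‖A g + t • β‖ ^ 2 + ‖C g + t * d‖ ^ 2 ≤ ‖g‖ ^ 2 + ‖t‖ ^ 2 := by
    intro g t
    have h1 := pow_le_pow_left₀ (norm_nonneg _) (hU (WithLp.toLp 2 (g, t))) 2
    rw [hUeq, WithLp.prod_norm_sq_eq_of_L2, WithLp.prod_norm_sq_eq_of_L2] at h1
    exact h1
  have hA : ∀ g, ‖A g‖ ≤ ‖g‖ := fun g => by
    have := hsq g 0
    simp only [zero_smul, add_zero, zero_mul, norm_zero] at this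
    exact le_of_sq_le_sq (by nlinarith [sq_nonneg ‖C g‖]) (norm_nonneg _)
  have hC : ∀ g, ‖C g‖ ≤ ‖g‖ := fun g => by
    have := hsq g 0
    simp only [zero_smul, add_zero, zero_mul, norm_zero] at this
    exact le_of_sq_le_sq (by nlinarith [sq_nonneg ‖A g‖]) (norm_nonneg _)
  have hβd : ‖β‖ ^ 2 + ‖d‖ ^ 2 ≤ 1 := by simpa using hsq 0 1
  have hβ : ‖β‖ ≤ 1 := by nlinarith [sq_nonneg ‖d‖, norm_nonneg β]
  have hd : ‖d‖ ≤ 1 := by nlinarith [sq_nonneg ‖β‖, norm_nonneg d]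
  have hAk : ∀ k g, ‖(A ^ k) g‖ ≤ ‖g‖ := by
    intro k
    induction k with
    | zero => simp
    | succ k ih => intro g; rw [pow_succ', mul_apply_eq_comp]; exact (hA _).trans (ih g)
  let a : ℕ → ℂ := fun k => Nat.casesOn k d fun k => C ((A ^ k) β)
  have ha : ∀ k, ‖a k‖ ≤ 1 := by
    rintro (_ | k)
    · exact hd
    · exact ((hC _).trans (hAk _ _)).trans hβ
  refine ⟨a, ha, fun z hz => ?_, fun u m ν hu hu0 => ?_⟩
  · have hgeo := summable_geometric_of_lt_one (norm_nonneg z) hz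
    have hsa : Summable fun k => a k * z ^ k :=
      Summable.of_norm_bounded hgeo fun k => by
        rw [norm_mul, norm_pow]
        exact mul_le_of_le_one_left (by positivity) (ha k)
    refine ⟨hsa, ?_⟩
    have hsg : Summable fun k => z ^ k • (A ^ k) β :=
      Summable.of_norm_bounded hgeo fun k => by
        rw [norm_smul, norm_pow]
        exact mul_le_of_le_one_right (by positivity) ((hAk _ _).trans hβ)
    set g := ∑' k, z ^ k • (A ^ k) β with hg
    have h1 : A (z • g) + (1 : ℂ) • β = g := by
      rw [map_smul, hg, A.map_tsum hsg, ← tsum_const_smul'', hsg.tsum_eq_zero_add, add_comm]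
      simp only [map_smul, pow_succ', mul_apply_eq_comp, smul_smul, pow_zero, one_smul, one_apply_eq_self]
    have h2 : C (z • g) + 1 * d = ∑' k, a k * z ^ k := by
      rw [map_smul, hg, C.map_tsum hsg, ← tsum_const_smul'', hsa.tsum_eq_zero_add, add_comm]
      simp only [map_smul, pow_succ', smul_eq_mul, pow_zero, one_mul, mul_one, a]
      congr 1
      exact tsum_congr fun k => by ring
    have := hsq (z • g) 1
    rw [h1, h2, norm_smul, norm_one, mul_pow] at this
    have hz2 : ‖z‖ ^ 2 * ‖g‖ ^ 2 ≤ ‖g‖ ^ 2 :=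
      mul_le_of_le_one_left (by positivity) (pow_le_one₀ (norm_nonneg z) hz.le)
    exact le_of_sq_le_sq (by linarith) zero_le_one
  · have hstep : ∀ N, u N = A (u (N + 1)) + m N • β ∧ ν N = C (u (N + 1)) + m N * d := by
      intro N
      have := (hUeq (u (N + 1)) (m N)).symm.trans (hu N)
      have h2 := (WithLp.toLp_injective 2) this
      exact ⟨(congrArg Prod.fst h2).symm, (congrArg Prod.snd h2).symm⟩
    have hsum : ∀ N, ∑ k ∈ Finset.range (N + 1), a k * m k = ν 0 - C ((A ^ N) (u (N + 1))) := by
      intro N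
      induction N with
      | zero => simp [(hstep 0).2, a, mul_comm]
      | succ N ih =>
        rw [Finset.sum_range_succ, ih]
        conv_lhs => rw [(hstep (N + 1)).1]
        simp only [map_add, map_smul, smul_eq_mul, pow_succ, mul_apply_eq_comp, a]
        ring
    rw [← tendsto_add_atTop_iff_nat 1]
    simp only [hsum]
    have : Tendsto (fun N => C ((A ^ N) (u (N + 1)))) atTop (nhds 0) := by
      refine squeeze_zero_norm (fun N => (hC _).trans (hAk _ _)) ?_
      simpa using (hu0.comp (tendsto_add_atTop_nat 1)).norm
    simpa using tendsto_const_nhds.sub this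

end Realization

section Moments

/-- The square-summable sequence `N ↦ ⟪x, Zᵢᴺ v⟫` attached to `(i, v, x)`. -/
noncomputable def momentSeq {ι : Type*} (Z : ι → H →L[ℂ] H) (hZ : ∀ i, ‖Z i‖ < 1)
    (p : ι × H × H) : lp (fun _ : ℕ => ℂ) 2 :=
  ⟨fun N => inner ℂ p.2.2 ((Z p.1 ^ N) p.2.1), by
    refine Memℓp.of_exponent_ge (q := 1) ?_ one_le_two
    refine memℓp_gen ?_
    simp only [ENNReal.toReal_one, Real.rpow_one]
    refine Summable.of_nonneg_of_le (fun _ => norm_nonneg _) (fun N => ?_)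
      ((summable_geometric_of_lt_one (norm_nonneg _) (hZ p.1)).mul_left (‖p.2.2‖ * ‖p.2.1‖))
    calc ‖inner ℂ p.2.2 ((Z p.1 ^ N) p.2.1)‖ ≤ ‖p.2.2‖ * ‖(Z p.1 ^ N) p.2.1‖ :=
          norm_inner_le_norm _ _
      _ ≤ ‖p.2.2‖ * (‖Z p.1‖ ^ N * ‖p.2.1‖) := by gcongr; exact norm_pow_apply_le _ _ _
      _ = _ := by ring⟩

theorem lp_two_norm_sq_eq_tsum (f : lp (fun _ : ℕ => ℂ) 2) :
    Summable (fun N => ‖f N‖ ^ 2) ∧ ‖f‖ ^ 2 = ∑' N, ‖f N‖ ^ 2 := by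
  have h1 := (lp.memℓp f).summable (by norm_num)
  have h2 := lp.norm_rpow_eq_tsum (p := 2) (by norm_num) f
  simp only [ENNReal.toReal_ofNat, Real.rpow_ofNat] at h1 h2
  exact ⟨h1, h2⟩

/-- If replacing `x` by `Wᵢ* x` contracts the `ℓ²` norm of all finite combinations of the moment
sequences of `Z`, then `W` is interpolated by a function in the unit ball of `H^∞`. -/
theorem interpolates_of_norm_moment_le {n : ℕ} (Z W : Fin n → H →L[ℂ] H) (hZ : ∀ i, ‖Z i‖ < 1)
    (hmom : ∀ p : (Fin n × H × H) →₀ ℂ,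
      ‖Finsupp.linearCombination ℂ
          (fun q : Fin n × H × H => momentSeq Z hZ (q.1, q.2.1, adjoint (W q.1) q.2.2)) p‖ ≤
        ‖Finsupp.linearCombination ℂ (momentSeq Z hZ) p‖) :
    InterpolatesHInfty Z W := by
  let α := Finsupp.linearCombination ℂ (momentSeq Z hZ)
  let γ := Finsupp.linearCombination ℂ
    (fun q : Fin n × H × H => momentSeq Z hZ (q.1, q.2.1, adjoint (W q.1) q.2.2))
  let s : ((Fin n × H × H) →₀ ℂ) →ₗ[ℂ] ((Fin n × H × H) →₀ ℂ) :=
    Finsupp.lmapDomain ℂ ℂ fun q => (q.1, Z q.1 q.2.1, q.2.2)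
  let ev : ℕ → lp (fun _ : ℕ => ℂ) 2 →ₗ[ℂ] ℂ := fun N =>
    { toFun := fun f => f N, map_add' := fun _ _ => rfl, map_smul' := fun _ _ => rfl }
  have hαs : ∀ p N, α (s p) N = α p (N + 1) := by
    intro p N
    have : (ev N ∘ₗ α ∘ₗ s) = ev (N + 1) ∘ₗ α := by
      refine Finsupp.lhom_ext fun q c => ?_
      simp [α, s, ev, momentSeq, Finsupp.mapDomain_single]
      exact Or.inl rfl
    exact LinearMap.congr_fun this p
  have hγs : ∀ p N, γ (s p) N = γ p (N + 1) := by
    intro p N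
    have : (ev N ∘ₗ γ ∘ₗ s) = ev (N + 1) ∘ₗ γ := by
      refine Finsupp.lhom_ext fun q c => ?_
      simp [γ, s, ev, momentSeq, Finsupp.mapDomain_single]
      exact Or.inl rfl
    exact LinearMap.congr_fun this p
  have hαn : ∀ p, ‖α p‖ ^ 2 = ‖α p 0‖ ^ 2 + ‖α (s p)‖ ^ 2 := by
    intro p
    obtain ⟨h1, h2⟩ := lp_two_norm_sq_eq_tsum (α p)
    rw [h2, h1.tsum_eq_zero_add, (lp_two_norm_sq_eq_tsum (α (s p))).2]
    simp only [hαs]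
  have hγn : ∀ p, ‖γ p‖ ^ 2 = ‖γ p 0‖ ^ 2 + ‖γ (s p)‖ ^ 2 := by
    intro p
    obtain ⟨h1, h2⟩ := lp_two_norm_sq_eq_tsum (γ p)
    rw [h2, h1.tsum_eq_zero_add, (lp_two_norm_sq_eq_tsum (γ (s p))).2]
    simp only [hγs]
  obtain ⟨L, hL, hLα⟩ := exists_contraction_extension α γ hmom
  obtain ⟨R, hR⟩ := exists_defect_operator L hL
  have hRn : ∀ p, ‖R (α p)‖ ^ 2 = ‖α p‖ ^ 2 - ‖γ p‖ ^ 2 := fun p => by rw [hR, hLα]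
  let u : ((Fin n × H × H) →₀ ℂ) →ₗ[ℂ] lp (fun _ : ℕ => ℂ) 2 := R.toLinearMap ∘ₗ α
  let toProd := (WithLp.linearEquiv 2 ℂ (lp (fun _ : ℕ => ℂ) 2 × ℂ)).symm.toLinearMap
  obtain ⟨U, hU, hUeq⟩ := exists_contraction_extension
    (toProd ∘ₗ (u ∘ₗ s).prod (ev 0 ∘ₗ α)) (toProd ∘ₗ u.prod (ev 0 ∘ₗ γ)) (by
      intro p
      refine le_of_sq_le_sq (le_of_eq ?_) (norm_nonneg _)
      rw [WithLp.prod_norm_sq_eq_of_L2, WithLp.prod_norm_sq_eq_of_L2]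
      change ‖R (α p)‖ ^ 2 + ‖γ p 0‖ ^ 2 = ‖R (α (s p))‖ ^ 2 + ‖α p 0‖ ^ 2
      rw [hRn, hRn, hαn p, hγn p]
      ring)
  obtain ⟨a, ha1, ha, hlim⟩ := exists_transfer_function U hU
  refine ⟨a, ha, fun i => ?_⟩
  have hsum : Summable fun k => a k • Z i ^ k := by
    refine Summable.of_norm_bounded_eventually_nat
      (summable_geometric_of_lt_one (norm_nonneg _) (hZ i)) ?_
    filter_upwards [eventually_gt_atTop 0] with k hk
    rw [norm_smul]
    exact (mul_le_of_le_one_left (norm_nonneg _) (ha1 k)).trans (norm_pow_le' _ hk)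
  suffices ∑' k, a k • Z i ^ k = W i from this ▸ hsum.hasSum
  ext v
  refine ext_inner_left ℂ fun x => ?_
  let p : ℕ → (Fin n × H × H) →₀ ℂ := fun N => (s ^ N) (Finsupp.single (i, v, x) 1)
  have hp : ∀ N, p (N + 1) = s (p N) := fun N => by simp only [p, pow_succ', Module.End.mul_apply]
  have hαp : ∀ N j, α (p N) j = α (p 0) (j + N) := by
    intro N
    induction N with
    | zero => intro j; rfl
    | succ N ih => intro j; rw [hp, hαs, ih, add_right_comm, add_assoc]
  have hαp0 : ∀ N, α (p 0) N = inner ℂ x ((Z i ^ N) v) := by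
    intro N
    simp [p, α, momentSeq]
  have hu0 : Tendsto (fun N => u (p N)) atTop (nhds 0) := by
    rw [tendsto_zero_iff_norm_tendsto_zero]
    have h0 : Tendsto (fun N => ‖α (p N)‖ ^ 2) atTop (nhds 0) := by
      refine (tendsto_sum_nat_add fun j => ‖α (p 0) j‖ ^ 2).congr fun N => ?_
      rw [(lp_two_norm_sq_eq_tsum _).2]
      simp only [hαp N]
    have h1 : Tendsto (fun N => ‖α (p N)‖) atTop (nhds 0) := by
      simpa using h0.sqrt
    refine squeeze_zero (fun _ => norm_nonneg _) (fun N => ?_) h1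
    refine le_of_sq_le_sq ?_ (norm_nonneg _)
    change ‖R (α (p N))‖ ^ 2 ≤ _
    rw [hRn]
    exact sub_le_self _ (by positivity)
  have hconv := hlim (fun N => u (p N)) (fun N => α (p N) 0) (fun N => γ (p N) 0)
    (fun N => by
      have := hUeq (p N)
      rw [hp N]
      exact this) hu0
  have hγp : γ (p 0) 0 = inner ℂ x (W i v) := by
    simp [p, γ, momentSeq, adjoint_inner_left]
  rw [hγp] at hconv
  refine tendsto_nhds_unique ?_ hconv
  have h1 := (((innerSL ℂ x).continuous.tendsto _).comp
    (((ContinuousLinearMap.apply ℂ H v).continuous.tendsto _).comp hsum.hasSum.tendsto_sum_nat))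
  refine Tendsto.congr (fun N => ?_) h1
  simp [inner_sum, inner_smul_right, hαp _ 0, hαp0]

end Moments

section Domination

variable {E : Type*} [NormedAddCommGroup E] [InnerProductSpace ℂ E] [CompleteSpace E]

/-- Testing a Lyapunov domination on the positive operators `∑ Dᴺ v ⊗ (Dᴺ v)*`. -/
theorem tsum_norm_inner_sq_le_of_dominates {D F : E →L[ℂ] E} (hD : ‖D‖ < 1)
    (hdom : ∀ Q : E →L[ℂ] E, 0 ≤ Q → D * Q * star D ≤ Q → F * Q * star F ≤ Q) (x v : E) :
    ∑' N : ℕ, ‖inner ℂ x (F ((D ^ N) v))‖ ^ 2 ≤ ∑' N : ℕ, ‖inner ℂ x ((D ^ N) v)‖ ^ 2 := by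
  let w : ℕ → E := fun N => (D ^ N) v
  have hsum : Summable fun N => InnerProductSpace.rankOne ℂ (w N) (w N) := by
    have hg : Summable fun N : ℕ => (‖D‖ ^ 2) ^ N * ‖v‖ ^ 2 :=
      (summable_geometric_of_lt_one (by positivity)
        (pow_lt_one₀ (norm_nonneg _) hD two_ne_zero)).mul_right _
    refine Summable.of_norm_bounded hg fun N => ?_
    rw [InnerProductSpace.norm_rankOne, ← sq, ← pow_mul, mul_comm 2, pow_mul, ← mul_pow]
    gcongr
    exact norm_pow_apply_le D N v
  set Q := ∑' N, InnerProductSpace.rankOne ℂ (w N) (w N) with hQ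
  let q : E → ℝ := fun y => ∑' N, ‖inner ℂ (w N) y‖ ^ 2
  have hqc : ∀ y, HasSum (fun N => ((‖inner ℂ (w N) y‖ ^ 2 : ℝ) : ℂ)) (inner ℂ y (Q y)) := by
    intro y
    have := ((innerSL ℂ y).comp (ContinuousLinearMap.apply ℂ E y)).hasSum hsum.hasSum
    refine this.congr_fun fun N => ?_
    simp only [ContinuousLinearMap.comp_apply, apply_apply, InnerProductSpace.rankOne_apply,
      map_smul, innerSL_apply_apply, smul_eq_mul]
    rw [← inner_conj_symm y, Complex.mul_conj, Complex.normSq_eq_norm_sq]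
  have hqs : ∀ y, Summable fun N => ‖inner ℂ (w N) y‖ ^ 2 := fun y =>
    Complex.summable_ofReal.1 (hqc y).summable
  have hqQ : ∀ y, inner ℂ (Q y) y = (q y : ℂ) := by
    intro y
    rw [← inner_conj_symm, ← (hqc y).tsum_eq, ← Complex.ofReal_tsum, Complex.conj_ofReal]
  have hconj : ∀ (G : E →L[ℂ] E) (y : E),
      inner ℂ ((Q - G * Q * star G) y) y = ((q y - q (star G y) : ℝ) : ℂ) := by
    intro G y
    rw [_root_.sub_apply, inner_sub_left, mul_apply_eq_comp, mul_apply_eq_comp, star_eq_adjoint,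
      ← adjoint_inner_right G, hqQ, hqQ]
    push_cast
    rfl
  have hq0 : 0 ≤ Q := by
    rw [nonneg_iff_isPositive, isPositive_iff_complex]
    intro y
    rw [hqQ, RCLike.re_to_complex, Complex.ofReal_re]
    exact ⟨rfl, tsum_nonneg fun N => by positivity⟩
  have hDQ : D * Q * star D ≤ Q := by
    rw [← sub_nonneg, nonneg_iff_isPositive, isPositive_iff_complex]
    intro y
    rw [hconj, RCLike.re_to_complex, Complex.ofReal_re]
    refine ⟨rfl, sub_nonneg.2 ?_⟩
    have : q (star D y) = ∑' N, ‖inner ℂ (w (N + 1)) y‖ ^ 2 := by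
      refine tsum_congr fun N => ?_
      rw [star_eq_adjoint, adjoint_inner_right]
      simp only [w, pow_succ', mul_apply_eq_comp]
    rw [this]
    simp only [q]
    rw [(hqs y).tsum_eq_zero_add]
    exact le_add_of_nonneg_left (by positivity)
  have hFQ := hdom Q hq0 hDQ
  rw [← sub_nonneg, nonneg_iff_isPositive, isPositive_iff_complex] at hFQ
  have := (hFQ x).2
  rw [hconj, RCLike.re_to_complex, Complex.ofReal_re, sub_nonneg] at this
  simp only [norm_inner_symm x]
  refine le_of_eq_of_le (tsum_congr fun N => ?_) this
  rw [star_eq_adjoint, adjoint_inner_right]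

theorem norm_mul_mul_star_le {D : E →L[ℂ] E} (hD : ‖D‖ ≤ 1) (Q : E →L[ℂ] E) :
    ‖D * Q * star D‖ ≤ ‖D‖ * ‖Q‖ := by
  refine (norm_mul_le _ _).trans ?_
  rw [norm_star]
  exact (mul_le_of_le_one_right (norm_nonneg _) hD).trans (norm_mul_le _ _)

theorem summable_smul_pow {D : E →L[ℂ] E} (hD : ‖D‖ < 1) {a : ℕ → ℂ}
    (ha : ∀ z : ℂ, ‖z‖ < 1 → Summable fun k => a k * z ^ k) : Summable fun k => a k • D ^ k := by
  refine Summable.of_norm_bounded_eventually_nat (ha (‖D‖ : ℂ) (by simpa using hD)).norm ?_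
  filter_upwards [eventually_gt_atTop 0] with k hk
  rw [norm_smul, norm_mul, norm_pow (‖D‖ : ℂ), Complex.norm_real, norm_norm]
  gcongr
  exact norm_pow_le' _ hk

end Domination

section MatrixOperators

variable {K : Type*} [NormedAddCommGroup K] [InnerProductSpace ℂ K]

theorem toOp_apply {m : ℕ} (q : Matrix (Fin m) (Fin m) (K →L[ℂ] K))
    (h : PiLp 2 (fun _ : Fin m => K)) (i : Fin m) : toOp q h i = ∑ j, q i j (h j) := by
  simp [toOp]

theorem toOp_mul {m : ℕ} (p q : Matrix (Fin m) (Fin m) (K →L[ℂ] K)) :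
    toOp (p * q) = toOp p * toOp q := by
  ext h i
  simp only [toOp_apply, mul_apply_eq_comp, Matrix.mul_apply, _root_.sum_apply, map_sum]
  exact Finset.sum_comm

theorem toOp_zero {m : ℕ} : toOp (0 : Matrix (Fin m) (Fin m) (K →L[ℂ] K)) = 0 := by
  ext h i
  simp [toOp_apply]

theorem toOp_add {m : ℕ} (p q : Matrix (Fin m) (Fin m) (K →L[ℂ] K)) :
    toOp (p + q) = toOp p + toOp q := by
  ext h i
  simp [toOp_apply, Finset.sum_add_distrib]

theorem toOp_diagonal_apply {m : ℕ} (d : Fin m → K →L[ℂ] K)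
    (h : PiLp 2 (fun _ : Fin m => K)) (i : Fin m) : toOp (Matrix.diagonal d) h i = d i (h i) := by
  rw [toOp_apply, Finset.sum_eq_single i]
  · simp
  · intro j _ hj
    simp [Matrix.diagonal_apply_ne' _ hj]
  · simp

theorem norm_toOp_diagonal_le {m : ℕ} (d : Fin m → K →L[ℂ] K) {c : ℝ} (hc : 0 ≤ c)
    (hd : ∀ i, ‖d i‖ ≤ c) : ‖toOp (Matrix.diagonal d)‖ ≤ c := by
  refine opNorm_le_bound _ hc fun h => le_of_sq_le_sq ?_ (by positivity)
  rw [mul_pow, PiLp.norm_sq_eq_of_L2, PiLp.norm_sq_eq_of_L2, Finset.mul_sum]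
  refine Finset.sum_le_sum fun i _ => ?_
  rw [toOp_diagonal_apply, ← mul_pow]
  gcongr
  exact (d i).le_of_opNorm_le (hd i) _

theorem toOp_bijective (m : ℕ) :
    Function.Bijective (toOp : Matrix (Fin m) (Fin m) (K →L[ℂ] K) → _) := by
  have hsingle : ∀ (q : Matrix (Fin m) (Fin m) (K →L[ℂ] K)) i j x,
      toOp q (PiLp.single 2 j x) i = q i j x := by
    intro q i j x
    rw [toOp_apply, Finset.sum_eq_single j]
    · simp
    · intro l _ hl
      simp [hl]
    · simp
  constructor
  · intro p q hpq
    ext i j x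
    rw [← hsingle, hpq, hsingle]
  · intro T
    let P := PiLp.continuousLinearEquiv 2 ℂ (fun _ : Fin m => K)
    refine ⟨Matrix.of fun i j => ContinuousLinearMap.proj i ∘L P.toContinuousLinearMap ∘L T ∘L
      P.symm.toContinuousLinearMap ∘L ContinuousLinearMap.single ℂ (fun _ : Fin m => K) j, ?_⟩
    ext h i
    have hh : h = ∑ j, PiLp.single 2 j (h j) := by
      ext l
      simp [Pi.single_apply]
    rw [toOp_apply]
    conv_rhs => rw [hh, map_sum, WithLp.ofLp_sum, Finset.sum_apply]
    rfl

/-- The block-diagonal operator `diag(Z₁,…,Zₙ) ⊗ 1ₖ` on `(Kⁿ)ᵏ`. -/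
noncomputable def diagOp {n : ℕ} (k : ℕ) (Z : Fin n → K →L[ℂ] K) :
    PiLp 2 (fun _ : Fin k => PiLp 2 (fun _ : Fin n => K)) →L[ℂ]
      PiLp 2 (fun _ : Fin k => PiLp 2 (fun _ : Fin n => K)) :=
  toOp (Matrix.diagonal fun _ => toOp (Matrix.diagonal Z))

theorem diagOp_apply {n k : ℕ} (Z : Fin n → K →L[ℂ] K)
    (h : PiLp 2 (fun _ : Fin k => PiLp 2 (fun _ : Fin n => K))) (i : Fin k) (a : Fin n) :
    diagOp k Z h i a = Z a (h i a) := by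
  rw [diagOp, toOp_diagonal_apply, toOp_diagonal_apply]

theorem diagOp_pow_apply {n k : ℕ} (Z : Fin n → K →L[ℂ] K) (N : ℕ)
    (h : PiLp 2 (fun _ : Fin k => PiLp 2 (fun _ : Fin n => K))) (i : Fin k) (a : Fin n) :
    (diagOp k Z ^ N) h i a = (Z a ^ N) (h i a) := by
  induction N with
  | zero => simp
  | succ N ih => rw [pow_succ', mul_apply_eq_comp, diagOp_apply, ih, pow_succ', mul_apply_eq_comp]

theorem exists_norm_le_lt_one {n : ℕ} {Z : Fin n → K →L[ℂ] K} (hZ : ∀ i, ‖Z i‖ < 1) :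
    ∃ c : ℝ, 0 ≤ c ∧ c < 1 ∧ ∀ i, ‖Z i‖ ≤ c := by
  rcases isEmpty_or_nonempty (Fin n) with h | h
  · exact ⟨0, le_rfl, one_pos, fun i => h.elim i⟩
  · obtain ⟨i, hi⟩ := Finite.exists_max fun i => ‖Z i‖
    exact ⟨‖Z i‖, norm_nonneg _, hZ i, hi⟩

theorem norm_diagOp_lt_one {n : ℕ} (k : ℕ) {Z : Fin n → K →L[ℂ] K} (hZ : ∀ i, ‖Z i‖ < 1) :
    ‖diagOp k Z‖ < 1 := by
  obtain ⟨c, hc0, hc1, hc⟩ := exists_norm_le_lt_one hZ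
  have h1 : ‖toOp (Matrix.diagonal Z)‖ ≤ c := norm_toOp_diagonal_le Z hc0 hc
  have h2 : ‖diagOp k Z‖ ≤ c := norm_toOp_diagonal_le _ hc0 fun _ => h1
  exact h2.trans_lt hc1

variable [CompleteSpace K]

theorem toOp_star {m : ℕ} (q : Matrix (Fin m) (Fin m) (K →L[ℂ] K)) :
    toOp (star q) = star (toOp q) := by
  rw [star_eq_adjoint, eq_adjoint_iff]
  intro x y
  simp only [PiLp.inner_apply, toOp_apply, sum_inner, inner_sum, Matrix.star_apply,
    star_eq_adjoint, adjoint_inner_left]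
  exact Finset.sum_comm

/-- `toOp` as an isomorphism of `*`-rings. -/
noncomputable def toOpEquiv (K : Type*) [NormedAddCommGroup K] [InnerProductSpace ℂ K]
    [CompleteSpace K] (m : ℕ) : Matrix (Fin m) (Fin m) (K →L[ℂ] K) ≃⋆+*
      (PiLp 2 (fun _ : Fin m => K) →L[ℂ] PiLp 2 (fun _ : Fin m => K)) :=
  { Equiv.ofBijective toOp (toOp_bijective m) with
    map_mul' := toOp_mul
    map_add' := toOp_add
    map_star' := toOp_star }

/-- The `*`-isomorphism `Mₖ(Mₙ(B(H))) ≃ B((Hⁿ)ᵏ)`. -/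
noncomputable def nestedOpEquiv (K : Type*) [NormedAddCommGroup K] [InnerProductSpace ℂ K]
    [CompleteSpace K] (k n : ℕ) :
    Matrix (Fin k) (Fin k) (Matrix (Fin n) (Fin n) (K →L[ℂ] K)) ≃⋆+*
      (PiLp 2 (fun _ : Fin k => PiLp 2 (fun _ : Fin n => K)) →L[ℂ]
        PiLp 2 (fun _ : Fin k => PiLp 2 (fun _ : Fin n => K))) :=
  StarRingEquiv.trans
    { RingEquiv.mapMatrix (m := Fin k) (toOpEquiv K n).toRingEquiv with
      map_star' := fun q => Matrix.ext fun i j => toOp_star (q j i) }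
    (toOpEquiv (PiLp 2 (fun _ : Fin n => K)) k)

theorem nestedOpEquiv_apply {k n : ℕ}
    (q : Matrix (Fin k) (Fin k) (Matrix (Fin n) (Fin n) (K →L[ℂ] K))) :
    nestedOpEquiv K k n q = toOp (ampl k toOp q) := rfl

theorem nestedOpEquiv_ampl_PhiMap {n k : ℕ} (Z : Fin n → K →L[ℂ] K)
    (q : Matrix (Fin k) (Fin k) (Matrix (Fin n) (Fin n) (K →L[ℂ] K))) :
    nestedOpEquiv K k n (ampl k (PhiMap Z) q) =
      diagOp k Z * nestedOpEquiv K k n q * star (diagOp k Z) := by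
  have hd : diagOp k Z = nestedOpEquiv K k n (Matrix.diagonal fun _ => Matrix.diagonal Z) := by
    rw [nestedOpEquiv_apply, diagOp]
    congr 1
    refine Matrix.ext fun i j => ?_
    rcases eq_or_ne i j with rfl | hij
    · simp [ampl]
    · simp [ampl, hij, toOp_zero]
  rw [hd, ← map_star, ← map_mul, ← map_mul]
  congr 1
  refine Matrix.ext fun i j => Matrix.ext fun a b => ?_
  simp [ampl, PhiMap, Matrix.star_eq_conjTranspose, Matrix.diagonal_mul, Matrix.mul_diagonal,
    Matrix.diagonal_conjTranspose, star_eq_adjoint, mul_def, comp_assoc]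

theorem starNonneg_iff {E A : Type*} [NormedAddCommGroup E] [InnerProductSpace ℂ E]
    [CompleteSpace E] [NonUnitalSemiring A] [Star A] (e : A ≃⋆+* (E →L[ℂ] E)) (a : A) :
    StarNonneg a ↔ 0 ≤ e a := by
  rw [CStarAlgebra.nonneg_iff_eq_star_mul_self]
  constructor
  · rintro ⟨b, rfl⟩
    exact ⟨e b, by rw [map_mul, map_star]⟩
  · rintro ⟨b, hb⟩
    refine ⟨e.symm b, EquivLike.injective e ?_⟩
    rw [map_mul, map_star, e.apply_symm_apply, hb]

theorem starLE_ampl_PhiMap_iff {n k : ℕ} (Z : Fin n → K →L[ℂ] K)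
    (q : Matrix (Fin k) (Fin k) (Matrix (Fin n) (Fin n) (K →L[ℂ] K))) :
    StarLE (ampl k (PhiMap Z) q) q ↔
      diagOp k Z * nestedOpEquiv K k n q * star (diagOp k Z) ≤ nestedOpEquiv K k n q := by
  rw [StarLE, starNonneg_iff (nestedOpEquiv K k n), map_sub, nestedOpEquiv_ampl_PhiMap, sub_nonneg]

theorem tendsto_norm_iterate_PhiMap {n k : ℕ} {Z : Fin n → K →L[ℂ] K} (hZ : ∀ i, ‖Z i‖ < 1)
    (q : Matrix (Fin k) (Fin k) (Matrix (Fin n) (Fin n) (K →L[ℂ] K))) :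
    Tendsto (fun N : ℕ => ‖toOp (ampl k (toOp (K := K) (m := n))
      ((ampl k (PhiMap Z))^[N] q))‖) atTop (nhds 0) := by
  have hle : ∀ N : ℕ, ‖nestedOpEquiv K k n ((ampl k (PhiMap Z))^[N] q)‖ ≤
      ‖diagOp k Z‖ ^ N * ‖nestedOpEquiv K k n q‖ := by
    intro N
    induction N with
    | zero => simp
    | succ N ih =>
      rw [Function.iterate_succ_apply', nestedOpEquiv_ampl_PhiMap]
      refine (norm_mul_mul_star_le (norm_diagOp_lt_one k hZ).le _).trans ?_
      rw [pow_succ', mul_assoc]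
      gcongr
  refine squeeze_zero (fun _ => norm_nonneg _) hle ?_
  simpa using (tendsto_pow_atTop_nhds_zero_of_lt_one (norm_nonneg _)
    (norm_diagOp_lt_one k hZ)).mul_const ‖nestedOpEquiv K k n q‖

theorem completelyLyapunovDominates_iff {n : ℕ} {Z : Fin n → K →L[ℂ] K} (hZ : ∀ i, ‖Z i‖ < 1)
    (W : Fin n → K →L[ℂ] K) :
    CompletelyLyapunovDominates Z W ↔
      ∀ k : ℕ, 1 ≤ k → ∀ Q, 0 ≤ Q → diagOp k Z * Q * star (diagOp k Z) ≤ Q →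
        diagOp k W * Q * star (diagOp k W) ≤ Q := by
  refine forall₂_congr fun k _ => ?_
  rw [(EquivLike.surjective (nestedOpEquiv K k n)).forall]
  refine forall_congr' fun q => ?_
  rw [starLE_ampl_PhiMap_iff, starLE_ampl_PhiMap_iff, starNonneg_iff (nestedOpEquiv K k n)]
  have := tendsto_norm_iterate_PhiMap hZ q
  tauto

theorem hasSum_diagOp {n : ℕ} (k : ℕ) {Z W : Fin n → K →L[ℂ] K} (hZ : ∀ i, ‖Z i‖ < 1) {a : ℕ → ℂ}
    (ha : ∀ z : ℂ, ‖z‖ < 1 → Summable fun k => a k * z ^ k)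
    (hW : ∀ i, HasSum (fun k => a k • Z i ^ k) (W i)) :
    HasSum (fun j => a j • diagOp k Z ^ j) (diagOp k W) := by
  have hs : Summable fun j => a j • diagOp k Z ^ j :=
    summable_smul_pow (E := PiLp 2 fun _ : Fin k => PiLp 2 fun _ : Fin n => K) (D := diagOp k Z)
      (norm_diagOp_lt_one k hZ) ha
  suffices ∑' j, a j • diagOp k Z ^ j = diagOp k W from this ▸ hs.hasSum
  ext h i b
  let ev : (PiLp 2 (fun _ : Fin k => PiLp 2 (fun _ : Fin n => K)) →L[ℂ]
      PiLp 2 (fun _ : Fin k => PiLp 2 (fun _ : Fin n => K))) →L[ℂ] K :=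
    PiLp.proj 2 (fun _ : Fin n => K) b ∘L PiLp.proj 2 (fun _ : Fin k => PiLp 2 fun _ : Fin n => K) i
      ∘L ContinuousLinearMap.apply ℂ _ h
  have h1 := ev.hasSum hs.hasSum
  have h2 := (ContinuousLinearMap.apply ℂ K (h i b)).hasSum (hW b)
  rw [diagOp_apply]
  refine h1.unique (h2.congr_fun fun j => ?_)
  change (a j • (diagOp k Z ^ j) h) i b = (a j • Z b ^ j) (h i b)
  rw [PiLp.smul_apply, PiLp.smul_apply, diagOp_pow_apply]
  rfl

end MatrixOperators

theorem norm_linearCombination_momentSeq_le {n : ℕ} {Z W : Fin n → H →L[ℂ] H}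
    (hZ : ∀ i, ‖Z i‖ < 1) (hdom : CompletelyLyapunovDominates Z W) (p : (Fin n × H × H) →₀ ℂ) :
    ‖Finsupp.linearCombination ℂ
        (fun q : Fin n × H × H => momentSeq Z hZ (q.1, q.2.1, adjoint (W q.1) q.2.2)) p‖ ≤
      ‖Finsupp.linearCombination ℂ (momentSeq Z hZ) p‖ := by
  rw [completelyLyapunovDominates_iff hZ] at hdom
  rcases Nat.eq_zero_or_pos p.support.card with h0 | hk
  · rw [Finset.card_eq_zero, Finsupp.support_eq_empty] at h0
    simp [h0]
  let e : Fin p.support.card ≃ p.support := p.support.equivFin.symm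
  let x : PiLp 2 (fun _ : Fin p.support.card => PiLp 2 (fun _ : Fin n => H)) :=
    WithLp.toLp 2 fun i => WithLp.toLp 2 fun _ => (e i).1.2.2
  let v : PiLp 2 (fun _ : Fin p.support.card => PiLp 2 (fun _ : Fin n => H)) :=
    WithLp.toLp 2 fun i => PiLp.single 2 (e i).1.1 (p (e i) • (e i).1.2.1)
  have hinner : ∀ (T : Fin n → H →L[ℂ] H)
      (y : PiLp 2 (fun _ : Fin p.support.card => PiLp 2 (fun _ : Fin n => H))),
      (∀ i a, y i a = T a (v i a)) →
      inner ℂ x y = ∑ q ∈ p.support, p q * inner ℂ q.2.2 (T q.1 q.2.1) := by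
    intro T y hy
    rw [PiLp.inner_apply, ← Finset.sum_coe_sort p.support, ← e.sum_comp]
    refine Finset.sum_congr rfl fun i _ => ?_
    rw [PiLp.inner_apply, Finset.sum_eq_single (e i).1.1]
    · rw [hy]
      simp [x, v, inner_smul_right]
    · intro a _ ha
      rw [hy]
      simp [v, ha]
    · simp
  have hmom := tsum_norm_inner_sq_le_of_dominates
    (E := PiLp 2 fun _ : Fin p.support.card => PiLp 2 fun _ : Fin n => H)
    (D := diagOp p.support.card Z) (F := diagOp p.support.card W)
    (norm_diagOp_lt_one p.support.card hZ) (hdom p.support.card hk) x v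
  have hcoe : ∀ (g : Fin n × H × H → Fin n × H × H) (N : ℕ),
      Finsupp.linearCombination ℂ (fun q => momentSeq Z hZ (g q)) p N =
        ∑ q ∈ p.support, p q * inner ℂ (g q).2.2 ((Z (g q).1 ^ N) (g q).2.1) := by
    intro g N
    rw [Finsupp.linearCombination_apply, Finsupp.sum, lp.coeFn_sum, Finset.sum_apply]
    rfl
  have hF : ∀ N : ℕ, inner ℂ x (diagOp p.support.card W ((diagOp p.support.card Z ^ N) v)) =
      Finsupp.linearCombination ℂ
        (fun q : Fin n × H × H => momentSeq Z hZ (q.1, q.2.1, adjoint (W q.1) q.2.2)) p N := by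
    intro N
    rw [hcoe fun q => (q.1, q.2.1, adjoint (W q.1) q.2.2), hinner (fun a => W a * Z a ^ N)]
    · simp only [adjoint_inner_left, mul_apply_eq_comp]
    · intro i a
      rw [diagOp_apply, diagOp_pow_apply, mul_apply_eq_comp]
  have hD : ∀ N : ℕ, inner ℂ x ((diagOp p.support.card Z ^ N) v) =
      Finsupp.linearCombination ℂ (momentSeq Z hZ) p N := by
    intro N
    rw [hinner (fun a => Z a ^ N) _ fun i a => diagOp_pow_apply Z N v i a]
    exact (hcoe id N).symm
  refine le_of_sq_le_sq ?_ (norm_nonneg _)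
  rw [(lp_two_norm_sq_eq_tsum _).2, (lp_two_norm_sq_eq_tsum _).2]
  simpa only [hF, hD] using hmom

theorem interpolation_iff_complete_lyapunov_domination
    {n : ℕ} (hn : 1 ≤ n) (Z W : Fin n → H →L[ℂ] H)
    (hZdistinct : Function.Injective Z)
    (hZ : ∀ i, ‖Z i‖ < 1) (hW : ∀ i, ‖W i‖ ≤ 1) :
    InterpolatesHInfty Z W ↔ CompletelyLyapunovDominates Z W := by
  constructor
  · rintro ⟨a, ha, haW⟩
    rw [completelyLyapunovDominates_iff hZ]
    intro k _ Q hQ hDQ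
    exact conj_le_of_hasSum (norm_diagOp_lt_one k hZ) ha
      (hasSum_diagOp k hZ (fun z hz => (ha z hz).1) haW) hQ hDQ
  · exact fun hdom =>
      interpolates_of_norm_moment_le Z W hZ (norm_linearCombination_momentSeq_le hZ hdom)
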